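/- arXiv:1001.2987 — 5 statements merged into one kernel-verified Lean document; each statement's English description precedes it below -/
import Mathlib

section
/- Let b ∈ ℝ and let S denote the set of smooth 2π-periodic functions ℝ → ℝ. Suppose A : (ℝ → ℝ) → (ℝ → ℝ) is an ℝ-linear map that sends S into S and restricts to a bijection of S onto S, and suppose that for every u ∈ S there exists w ∈ S with A w = 2·(Au)·u' + u·(Au)' and w − w'' = b·(u − u'')·u' + u·(u − u'')'. Let 𝟏 denote the constant function with value 1. Then the derivative of A𝟏 vanishes identically, i.e. A𝟏 is a constant function. -/
/-- The set of smooth `2π`-periodic functions `ℝ → ℝ`, identified with `C^∞(S¹)`. -/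
def SmoothPeriodic : Set (ℝ → ℝ) :=
  {f | ContDiff ℝ (⊤ : ℕ∞) f ∧ Function.Periodic f (2 * Real.pi)}

/-- A periodic function with derivative `c * f`, where `c ≠ 0`, vanishes. -/
theorem Function.Periodic.eq_zero_of_hasDerivAt_const_mul {f : ℝ → ℝ} {c T : ℝ}
    (hf : Function.Periodic f T) (hT : T ≠ 0) (hc : c ≠ 0)
    (hd : ∀ x, HasDerivAt f (c * f x) x) (x : ℝ) : f x = 0 := by
  have hder : ∀ y, HasDerivAt (fun y => f y * Real.exp (-(c * y))) 0 y := fun y => by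
    have hexp : HasDerivAt (fun y => Real.exp (-(c * y))) (Real.exp (-(c * y)) * -(c * 1)) y :=
      ((hasDerivAt_id y).const_mul c).neg.exp
    exact ((hd y).mul hexp).congr_deriv (by ring)
  have hconst := is_const_of_deriv_eq_zero (fun y => (hder y).differentiableAt)
    (fun y => (hder y).deriv) (x + T) x
  simp only [hf x] at hconst
  by_contra hx
  have hexp := Real.exp_injective (mul_left_cancel₀ hx hconst)
  exact mul_ne_zero hc hT (by linarith)

/-- The operator `1 - ∂ₓ²` is injective on smooth periodic functions. -/
theorem SmoothPeriodic.eq_zero_of_sub_deriv_deriv_eq_zero {w : ℝ → ℝ}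
    (hw : w ∈ SmoothPeriodic) (h : ∀ x, w x - deriv (deriv w) x = 0) : w = 0 := by
  obtain ⟨hsmooth, hper⟩ := hw
  have hT : 2 * Real.pi ≠ 0 := Real.two_pi_pos.ne'
  have hd : ∀ x, HasDerivAt w (deriv w x) x := fun x =>
    (hsmooth.differentiable (by simp) x).hasDerivAt
  have hd' : ∀ x, HasDerivAt (deriv w) (w x) x := fun x => by
    have hdiff : Differentiable ℝ (deriv w) :=
      (contDiff_infty_iff_deriv.1 hsmooth).2.differentiable (by simp)
    rw [sub_eq_zero.1 (h x)]
    exact (hdiff x).hasDerivAt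
  have hper' : Function.Periodic (deriv w) (2 * Real.pi) := fun x => by
    rw [← deriv_comp_add_const, funext hper]
  have hsum := (hper.add hper').eq_zero_of_hasDerivAt_const_mul hT one_ne_zero fun x =>
    ((hd x).add (hd' x)).congr_deriv (by simp [add_comm])
  funext x
  refine hper.eq_zero_of_hasDerivAt_const_mul hT (neg_ne_zero.2 one_ne_zero) (fun y => ?_) x
  have hy : w y + deriv w y = 0 := hsum y
  exact (hd y).congr_deriv (by linarith)

/-- If the periodic `b`-equation is the Euler equation with respect to the inertia
operator `A`, then `A𝟏` is a constant function. -/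
theorem A_one_is_constant (b : ℝ) (A : (ℝ → ℝ) → (ℝ → ℝ))
    (hlin : IsLinearMap ℝ A)
    (hmaps : ∀ f ∈ SmoothPeriodic, A f ∈ SmoothPeriodic)
    (hbij : Set.BijOn A SmoothPeriodic SmoothPeriodic)
    (heuler : ∀ u ∈ SmoothPeriodic, ∃ w ∈ SmoothPeriodic,
      (∀ x, A w x = 2 * A u x * deriv u x + u x * deriv (A u) x) ∧
      (∀ x, w x - deriv (deriv w) x =
        b * (u x - deriv (deriv u) x) * deriv u x
          + u x * deriv (fun y => u y - deriv (deriv u) y) x)) :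
    ∀ x, deriv (A (fun _ => (1:ℝ))) x = 0 := by
  intro x
  obtain ⟨w, hw, hAw, hLw⟩ := heuler (fun _ => 1) ⟨contDiff_const, fun _ => rfl⟩
  have hw0 : w = 0 :=
    SmoothPeriodic.eq_zero_of_sub_deriv_deriv_eq_zero hw fun y => by simpa using hLw y
  have hx := hAw x
  rw [hw0, hlin.map_zero] at hx
  simpa using hx.symm
end

section
/- Let b ∈ ℝ and let S denote the set of smooth 2π-periodic functions ℝ → ℝ. Suppose A : (ℝ → ℝ) → (ℝ → ℝ) is an ℝ-linear map that sends S into S, restricts to a bijection of S onto S, satisfies A𝟏 = 𝟏 (where 𝟏 is the constant function 1), and has the property that for every u ∈ S there exists w ∈ S with A w = 2·(Au)·u' + u·(Au)' and w − w'' = b·(u − u'')·u' + u·(u − u'')'. Then for every u ∈ S there exists w ∈ S with A w = 2·u' + (Au)' and w − w'' = b·u' + (u − u'')'. -/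
theorem SmoothPeriodic.add_one {u : ℝ → ℝ} (hu : u ∈ SmoothPeriodic) :
    u + (fun _ => (1 : ℝ)) ∈ SmoothPeriodic :=
  ⟨hu.1.add contDiff_const, fun x => by simp [hu.2 x]⟩

theorem SmoothPeriodic.sub {u v : ℝ → ℝ} (hu : u ∈ SmoothPeriodic) (hv : v ∈ SmoothPeriodic) :
    u - v ∈ SmoothPeriodic :=
  ⟨hu.1.sub hv.1, hu.2.sub hv.2⟩

theorem SmoothPeriodic.deriv_deriv_sub {u v : ℝ → ℝ} (hu : u ∈ SmoothPeriodic)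
    (hv : v ∈ SmoothPeriodic) (x : ℝ) :
    deriv (deriv (u - v)) x = deriv (deriv u) x - deriv (deriv v) x := by
  have hdiff {f : ℝ → ℝ} (hf : f ∈ SmoothPeriodic) :
      Differentiable ℝ f ∧ Differentiable ℝ (deriv f) := by
    have h := contDiff_infty_iff_deriv.1 hf.1
    exact ⟨h.1, h.2.differentiable (by simp)⟩
  have h : deriv (u - v) = deriv u - deriv v :=
    funext fun y => deriv_sub ((hdiff hu).1 y) ((hdiff hv).1 y)
  rw [h, deriv_sub ((hdiff hu).2 x) ((hdiff hv).2 x)]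

theorem deriv_add_one (u : ℝ → ℝ) : deriv (u + fun _ => (1 : ℝ)) = deriv u :=
  funext fun _ => deriv_add_const _

/-- If `A𝟏 = 𝟏` and the periodic `b`-equation is the Euler equation with respect to the
inertia operator `A`, then the linearized identity
`A⁻¹(2u_x + (Au)_x) = L⁻¹(bu_x + (Lu)_x)` holds for all `u ∈ S`. -/
theorem linearized_euler_identity (b : ℝ) (A : (ℝ → ℝ) → (ℝ → ℝ))
    (hlin : IsLinearMap ℝ A)
    (hmaps : ∀ f ∈ SmoothPeriodic, A f ∈ SmoothPeriodic)
    (hbij : Set.BijOn A SmoothPeriodic SmoothPeriodic)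
    (hone : A (fun _ => (1:ℝ)) = fun _ => (1:ℝ))
    (heuler : ∀ u ∈ SmoothPeriodic, ∃ w ∈ SmoothPeriodic,
      (∀ x, A w x = 2 * A u x * deriv u x + u x * deriv (A u) x) ∧
      (∀ x, w x - deriv (deriv w) x =
        b * (u x - deriv (deriv u) x) * deriv u x
          + u x * deriv (fun y => u y - deriv (deriv u) y) x)) :
    ∀ u ∈ SmoothPeriodic, ∃ w ∈ SmoothPeriodic,
      (∀ x, A w x = 2 * deriv u x + deriv (A u) x) ∧
      (∀ x, w x - deriv (deriv w) x =
        b * deriv u x + deriv (fun y => u y - deriv (deriv u) y) x) := by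
  intro u hu
  obtain ⟨w₀, hw₀, hA₀, hL₀⟩ := heuler u hu
  obtain ⟨w₁, hw₁, hA₁, hL₁⟩ := heuler _ (SmoothPeriodic.add_one hu)
  refine ⟨w₁ - w₀, SmoothPeriodic.sub hw₁ hw₀, fun x => ?_, fun x => ?_⟩
  · have h := hA₁ x
    rw [hlin.map_add, hone, deriv_add_one, deriv_add_one] at h
    rw [hlin.map_sub, Pi.sub_apply, h, hA₀ x]
    simp only [Pi.add_apply]
    ring
  · have h := hL₁ x
    have hderiv : deriv (fun y => (u + fun _ => (1 : ℝ) : ℝ → ℝ) y - deriv (deriv u) y) x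
        = deriv (fun y => u y - deriv (deriv u) y) x := by
      rw [← deriv_add_one fun y => u y - deriv (deriv u) y]
      congr 1
      funext y
      simp only [Pi.add_apply]
      ring
    rw [deriv_add_one, hderiv] at h
    rw [SmoothPeriodic.deriv_deriv_sub hw₁ hw₀]
    simp only [Pi.add_apply, Pi.sub_apply] at h ⊢
    linear_combination h - hL₀ x
end

section
/- Let b ∈ ℝ and let S_ℂ denote the set of smooth 2π-periodic functions ℝ → ℂ; write e_n(x) = exp(inx). Suppose A : (ℝ → ℂ) → (ℝ → ℂ) is a ℂ-linear map that sends S_ℂ into S_ℂ, restricts to a bijection of S_ℂ onto S_ℂ, and has the property that for every u ∈ S_ℂ there exists w ∈ S_ℂ with A w = 2·u' + (Au)' and w − w'' = b·u' + (u − u'')'. Then for every integer n ≠ 0, the function v := A e_n satisfies the ordinary differential equation v'(x) = i·α_n·v(x) − 2·i·n·exp(inx) for all x ∈ ℝ, where α_n := n + b·n/(1 + n²). -/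
/-- The set of smooth `2π`-periodic functions `ℝ → ℂ`, identified with `C^∞(S¹, ℂ)`. -/
def SmoothPeriodicC : Set (ℝ → ℂ) :=
  {f | ContDiff ℝ (⊤ : ℕ∞) f ∧ Function.Periodic f (2 * Real.pi)}

/-- The exponential `e_n(x) = exp(inx)`. -/
noncomputable def expC (n : ℤ) : ℝ → ℂ := fun x => Complex.exp (Complex.I * n * x)

theorem hasDerivAt_expC (n : ℤ) (x : ℝ) :
    HasDerivAt (expC n) (Complex.I * n * expC n x) x := by
  have h : HasDerivAt (fun y : ℝ => Complex.I * n * (y : ℂ)) (Complex.I * n) x := by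
    simpa using (Complex.ofRealCLM.hasDerivAt (x := x)).const_mul (Complex.I * (n : ℂ))
  exact h.cexp.congr_deriv (mul_comm _ _)

theorem deriv_expC (n : ℤ) : deriv (expC n) = fun x => Complex.I * n * expC n x :=
  funext fun x => (hasDerivAt_expC n x).deriv

theorem deriv_deriv_expC (n : ℤ) :
    deriv (deriv (expC n)) = fun x => -(n : ℂ) ^ 2 * expC n x := by
  funext x
  rw [deriv_expC, ((hasDerivAt_expC n x).const_mul _).deriv]
  linear_combination (n : ℂ) ^ 2 * expC n x * Complex.I_sq

theorem expC_mem_smoothPeriodicC (n : ℤ) : expC n ∈ SmoothPeriodicC := by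
  refine ⟨?_, fun x => ?_⟩
  · exact (contDiff_const.mul Complex.ofRealCLM.contDiff).cexp
  · simp only [expC]
    rw [Complex.exp_eq_exp_iff_exists_int]
    exact ⟨n, by push_cast; ring⟩

/-- A periodic solution of `h' = a h` with `a` real and nonzero vanishes. -/
theorem Function.Periodic.eq_zero_of_hasDerivAt_mul {h : ℝ → ℂ} {a T : ℝ}
    (hper : Function.Periodic h T) (ha : a ≠ 0) (hT : T ≠ 0)
    (hderiv : ∀ x, HasDerivAt h (a * h x) x) (x : ℝ) : h x = 0 := by
  have hexp (y : ℝ) : HasDerivAt (fun y : ℝ => (Real.exp (-a * y) : ℂ))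
      ((Real.exp (-a * y) * -a : ℝ) : ℂ) y := by
    have := ((hasDerivAt_id y).const_mul (-a)).exp
    simpa using this.ofReal_comp
  have hconst (y : ℝ) : HasDerivAt (fun y : ℝ => h y * (Real.exp (-a * y) : ℂ)) 0 y := by
    refine ((hderiv y).mul (hexp y)).congr_deriv ?_
    push_cast
    ring
  have heq : h (x + T) * (Real.exp (-a * (x + T)) : ℂ) = h x * (Real.exp (-a * x) : ℂ) :=
    is_const_of_deriv_eq_zero (fun y => (hconst y).differentiableAt)
      (fun y => (hconst y).deriv) (x + T) x
  rw [hper x] at heq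
  by_contra hx
  have hinj := Real.exp_injective (Complex.ofReal_injective (mul_left_cancel₀ hx heq))
  have : a * T = 0 := by linarith
  exact (mul_ne_zero ha hT) this

/-- The operator `1 - ∂ₓ²` is injective on smooth periodic functions. -/
theorem eq_zero_of_deriv_deriv_eq_self {d : ℝ → ℂ} (hd : d ∈ SmoothPeriodicC)
    (h : ∀ x, deriv (deriv d) x = d x) : d = 0 := by
  obtain ⟨hsmooth, hper⟩ := hd
  have hT : 2 * Real.pi ≠ 0 := by positivity
  have hd1 (x : ℝ) : HasDerivAt d (deriv d x) x :=
    (hsmooth.differentiable (by simp) x).hasDerivAt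
  have hd2 (x : ℝ) : HasDerivAt (deriv d) (d x) x := by
    have hs : ContDiff ℝ (⊤ : ℕ∞) (deriv d) := (contDiff_infty_iff_deriv.1 hsmooth).2
    simpa [h x] using (hs.differentiable (by simp) x).hasDerivAt
  have hper' : Function.Periodic (deriv d) (2 * Real.pi) := fun x => by
    rw [← deriv_comp_add_const, hper.funext]
  have hsum (x : ℝ) : d x + deriv d x = 0 :=
    (hper.add hper').eq_zero_of_hasDerivAt_mul one_ne_zero hT
      (fun y => ((hd1 y).add (hd2 y)).congr_deriv (by simp [add_comm])) x
  funext x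
  refine hper.eq_zero_of_hasDerivAt_mul (neg_ne_zero.2 one_ne_zero) hT
    (fun y => (hd1 y).congr_deriv ?_) x
  push_cast
  linear_combination hsum y

/-- If `A` satisfies the linearized Euler identity, then `v := A e_n` solves the ODE
`v' = iα_n v - 2in e^{inx}` with `α_n = n + bn/(1+n²)`. -/
theorem inertia_operator_ode (b : ℝ) (A : (ℝ → ℂ) → (ℝ → ℂ))
    (hlin : IsLinearMap ℂ A)
    (hmaps : ∀ f ∈ SmoothPeriodicC, A f ∈ SmoothPeriodicC)
    (hbij : Set.BijOn A SmoothPeriodicC SmoothPeriodicC)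
    (heuler : ∀ u ∈ SmoothPeriodicC, ∃ w ∈ SmoothPeriodicC,
      (∀ x, A w x = 2 * deriv u x + deriv (A u) x) ∧
      (∀ x, w x - deriv (deriv w) x =
        b * deriv u x + deriv (fun y => u y - deriv (deriv u) y) x)) :
    ∀ n : ℤ, n ≠ 0 → ∀ x : ℝ,
      deriv (A (expC n)) x =
        Complex.I * ((n : ℂ) + (b : ℂ) * (n : ℂ) / (1 + (n : ℂ) ^ 2)) * A (expC n) x
          - 2 * Complex.I * (n : ℂ) * Complex.exp (Complex.I * n * x) := by
  intro n _ x
  set c : ℂ := Complex.I * ((n : ℂ) + (b : ℂ) * (n : ℂ) / (1 + (n : ℂ) ^ 2)) with hc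
  obtain ⟨w, hw, hAw, hLw⟩ := heuler _ (expC_mem_smoothPeriodicC n)
  have hn : (1 + (n : ℂ) ^ 2) ≠ 0 := by
    have : (0 : ℝ) < 1 + (n : ℝ) ^ 2 := by positivity
    exact_mod_cast this.ne'
  have he := expC_mem_smoothPeriodicC n
  have hd : w - c • expC n ∈ SmoothPeriodicC :=
    ⟨hw.1.sub (he.1.const_smul c), hw.2.sub (he.2.smul c)⟩
  have hderiv : deriv (w - c • expC n) = deriv w - c • deriv (expC n) := by
    funext y
    exact ((hw.1.differentiable (by simp) y).hasDerivAt.sub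
      ((hasDerivAt_expC n y).differentiableAt.hasDerivAt.const_smul c)).deriv
  have hself (y : ℝ) : deriv (deriv (w - c • expC n)) y = (w - c • expC n) y := by
    have hw' : ContDiff ℝ (⊤ : ℕ∞) (deriv w) := (contDiff_infty_iff_deriv.1 hw.1).2
    have he' : ContDiff ℝ (⊤ : ℕ∞) (deriv (expC n)) := (contDiff_infty_iff_deriv.1 he.1).2
    have hderiv2 : deriv (deriv (w - c • expC n)) y =
        deriv (deriv w) y - c * deriv (deriv (expC n)) y := by
      rw [hderiv]
      exact ((hw'.differentiable (by simp) y).hasDerivAt.sub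
        ((he'.differentiable (by simp) y).hasDerivAt.const_smul c)).deriv
    have hL := hLw y
    have hLe : deriv (fun z => expC n z - deriv (deriv (expC n)) z) y =
        (1 + (n : ℂ) ^ 2) * (Complex.I * n * expC n y) := by
      rw [deriv_deriv_expC, ← ((hasDerivAt_expC n y).const_mul (1 + (n : ℂ) ^ 2)).deriv]
      congr 1
      funext z
      ring
    have hcn : c * (1 + (n : ℂ) ^ 2) = Complex.I * (n * (1 + (n : ℂ) ^ 2) + b * n) := by
      rw [hc]
      field_simp
    rw [hLe, deriv_expC] at hL
    rw [hderiv2, deriv_deriv_expC]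
    simp only [Pi.sub_apply, Pi.smul_apply, smul_eq_mul]
    linear_combination -hL + expC n y * hcn
  have hweq : w = c • expC n := sub_eq_zero.1 (eq_zero_of_deriv_deriv_eq_self hd hself)
  have hA := hAw x
  rw [hweq, hlin.map_smul, deriv_expC] at hA
  simp only [Pi.smul_apply, smul_eq_mul, expC] at hA
  linear_combination -hA
end

section
/- Let n be a nonzero integer. There is no differentiable function v : ℝ → ℂ that is 2π-periodic and satisfies v'(x) = i·n·v(x) − 2·i·n·exp(inx) for all x ∈ ℝ. -/
/-- Every solution of the resonantly forced linear ODE `v' = a v + c e^{ax}` has the form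
`(v 0 + c x) e^{ax}`. -/
theorem eq_add_mul_exp_of_hasDerivAt_resonant {a c : ℂ} {v : ℝ → ℂ}
    (hv : ∀ x : ℝ, HasDerivAt v (a * v x + c * Complex.exp (a * x)) x) (x : ℝ) :
    v x = (v 0 + c * x) * Complex.exp (a * x) := by
  have hg : ∀ y : ℝ, HasDerivAt (fun y : ℝ => v y * Complex.exp (-(a * y)) - c * y) 0 y := by
    intro y
    have hid : HasDerivAt (fun y : ℝ => (y : ℂ)) 1 y := Complex.ofRealCLM.hasDerivAt
    have hexp : Complex.exp (a * y) * Complex.exp (-(a * y)) = 1 := by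
      rw [← Complex.exp_add, add_neg_cancel, Complex.exp_zero]
    refine (((hv y).mul (hid.const_mul a).neg.cexp).sub (hid.const_mul c)).congr_deriv ?_
    linear_combination c * hexp
  have hconst := is_const_of_deriv_eq_zero (fun y => (hg y).differentiableAt)
    (fun y => (hg y).deriv) x 0
  have hexp : Complex.exp (a * x) * Complex.exp (-(a * x)) = 1 := by
    rw [← Complex.exp_add, add_neg_cancel, Complex.exp_zero]
  simp only [Complex.ofReal_zero, mul_zero, neg_zero, Complex.exp_zero, mul_one, sub_zero]
    at hconst
  linear_combination Complex.exp (a * x) * hconst - v x * hexp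

/-- The resonant ODE `v' = inv - 2in e^{inx}` (the case `b = 0`) has no
`2π`-periodic solution when `n ≠ 0`. -/
theorem no_periodic_solution_resonant (n : ℤ) (hn : n ≠ 0) :
    ¬ ∃ v : ℝ → ℂ, Differentiable ℝ v ∧ Function.Periodic v (2 * Real.pi) ∧
      ∀ x : ℝ, deriv v x =
        Complex.I * n * v x - 2 * Complex.I * n * Complex.exp (Complex.I * n * x) := by
  rintro ⟨v, hd, hp, hv⟩
  have hsol := eq_add_mul_exp_of_hasDerivAt_resonant (a := Complex.I * n)
    (c := -(2 * Complex.I * n))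
    (fun x => (hd x).hasDerivAt.congr_deriv (by rw [hv x]; ring)) (2 * Real.pi)
  have hexp : Complex.exp (Complex.I * n * ((2 * Real.pi : ℝ) : ℂ)) = 1 := by
    rw [← Complex.exp_int_mul_two_pi_mul_I n]
    congr 1
    push_cast
    ring
  rw [hexp, mul_one, hp.eq, left_eq_add] at hsol
  simp [hn, Real.pi_ne_zero] at hsol
end

section
/- Let p and k be integers with p ≠ 0 and k ≠ 0. If p·(1 + (p + k)²) + (1 + p²)·(p + k) = 0, then k = −2p. -/
/-- Diophantine step: if `p(1+(p+k)²) + (1+p²)(p+k) = 0` with `p ≠ 0` and `k ≠ 0`,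
then `k = -2p`. -/
theorem diophantine_step (p k : ℤ) (hp : p ≠ 0) (hk : k ≠ 0)
    (h : p * (1 + (p + k) ^ 2) + (1 + p ^ 2) * (p + k) = 0) :
    k = -2 * p := by
  have hfac : (p + (p + k)) * (1 + p * (p + k)) = 0 := by linear_combination h
  rcases mul_eq_zero.mp hfac with hsum | hprod
  · linarith
  · have hneg : p * (p + k) = -1 := by linarith
    rcases Int.mul_eq_neg_one_iff_eq_one_or_neg_one.mp hneg with ⟨_, _⟩ | ⟨_, _⟩ <;> linarith
end
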